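/- arXiv:2409.11288 — 4 statements merged into one kernel-verified Lean document; each statement's English description precedes it below -/
import Mathlib

section
/- Suppose that (i) there are no nonzero t ∈ T and u ∈ D^⊥ with sign(t_j) = sign(u_j) for all j, and (ii) for every nonzero t ∈ T, with F = {x ∈ P̄ : x·t = max_{y ∈ P̄} y·t} and Z = {j : x_j = 0 for all x ∈ F}, there is no nonzero u ∈ D^⊥ with u ≥ 0 componentwise and {j : u_j > 0} = Z. Then the map f is a bijection from ℝ^{d_P} onto {z ∈ ℝ^d : z > 0}. -/
open Filter Topology

/-- The mean of the vectors `v k` with weights proportional to `exp (v k ⬝ᵥ t)`. -/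
noncomputable def expMean {ι κ : Type*} [Fintype ι] [Fintype κ] (v : κ → ι → ℝ) (t : ι → ℝ) :
    ι → ℝ :=
  Finset.univ.centerMass (fun k => Real.exp (v k ⬝ᵥ t)) v

/-- The probability vectors in the kernel of the matrix `A`. -/
def closedPolytope {l m : ℕ} (A : Matrix (Fin l) (Fin m) ℝ) : Set (Fin m → ℝ) :=
  {y | A.mulVec y = 0 ∧ (∀ j, 0 ≤ y j) ∧ ∑ j, y j = 1}

lemma sum_exp_pos {ι κ : Type*} [Fintype ι] [Fintype κ] [Nonempty κ] (v : κ → ι → ℝ)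
    (t : ι → ℝ) : 0 < ∑ k, Real.exp (v k ⬝ᵥ t) :=
  Finset.sum_pos (fun _ _ => Real.exp_pos _) Finset.univ_nonempty

lemma expMean_apply {ι κ : Type*} [Fintype ι] [Fintype κ] (v : κ → ι → ℝ) (t : ι → ℝ) (j : ι) :
    expMean v t j = (∑ k, Real.exp (v k ⬝ᵥ t) * v k j) / ∑ k, Real.exp (v k ⬝ᵥ t) := by
  simp [expMean, Finset.centerMass, div_eq_inv_mul]

lemma expMean_dotProduct {ι κ : Type*} [Fintype ι] [Fintype κ] (v : κ → ι → ℝ) (t c : ι → ℝ) :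
    expMean v t ⬝ᵥ c =
      (∑ k, Real.exp (v k ⬝ᵥ t) * (v k ⬝ᵥ c)) / ∑ k, Real.exp (v k ⬝ᵥ t) := by
  simp [expMean, Finset.centerMass, div_eq_inv_mul, sum_dotProduct]

/-- Chebyshev's sum inequality in strict form: a strictly increasing function of a nonconstant
variable is positively correlated with it. -/
lemma sum_mul_sum_lt_of_strictMono {κ : Type*} [Fintype κ] {φ : ℝ → ℝ} (hφ : StrictMono φ)
    {b s : κ → ℝ} (hb : ∀ k, 0 < b k) (hs : ∃ k l, s k ≠ s l) :
    (∑ k, b k * φ (s k)) * (∑ k, b k * s k) < (∑ k, b k * φ (s k) * s k) * ∑ k, b k := by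
  obtain ⟨k₀, l₀, h₀⟩ := hs
  have hnn : ∀ x y : ℝ, 0 ≤ (φ x - φ y) * (x - y) := by
    intro x y
    rcases le_total x y with h | h
    · exact mul_nonneg_of_nonpos_of_nonpos (sub_nonpos.2 (hφ.monotone h)) (sub_nonpos.2 h)
    · exact mul_nonneg (sub_nonneg.2 (hφ.monotone h)) (sub_nonneg.2 h)
  have hpos : 0 < (φ (s k₀) - φ (s l₀)) * (s k₀ - s l₀) :=
    lt_of_le_of_ne (hnn _ _) (mul_ne_zero (sub_ne_zero.2 (hφ.injective.ne h₀))
      (sub_ne_zero.2 h₀)).symm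
  have hsum : 0 < ∑ k, ∑ l, b k * b l * ((φ (s k) - φ (s l)) * (s k - s l)) := by
    have h1 : ∀ k l, 0 ≤ b k * b l * ((φ (s k) - φ (s l)) * (s k - s l)) := fun k l =>
      mul_nonneg (mul_pos (hb k) (hb l)).le (hnn _ _)
    refine Finset.sum_pos' (fun k _ => Finset.sum_nonneg fun l _ => h1 k l)
      ⟨k₀, Finset.mem_univ _, ?_⟩
    exact Finset.sum_pos' (fun l _ => h1 k₀ l)
      ⟨l₀, Finset.mem_univ _, mul_pos (mul_pos (hb _) (hb _)) hpos⟩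
  have hexp : ∑ k, ∑ l, b k * b l * ((φ (s k) - φ (s l)) * (s k - s l)) =
      2 * ((∑ k, b k * φ (s k) * s k) * (∑ k, b k) -
        (∑ k, b k * φ (s k)) * ∑ k, b k * s k) := by
    have h2 : ∑ k, ∑ l, b k * b l * ((φ (s k) - φ (s l)) * (s k - s l)) =
        (∑ k, ∑ l, (b k * φ (s k) * s k) * b l) + (∑ k, ∑ l, b k * (b l * φ (s l) * s l))
        - (∑ k, ∑ l, (b k * φ (s k)) * (b l * s l))
        - ∑ k, ∑ l, (b k * s k) * (b l * φ (s l)) := by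
      simp only [← Finset.sum_add_distrib, ← Finset.sum_sub_distrib]
      refine Finset.sum_congr rfl fun k _ => Finset.sum_congr rfl fun l _ => by ring
    rw [h2]
    simp only [← Finset.sum_mul_sum]
    ring
  linarith

lemma expMean_sub_dotProduct_pos {ι κ : Type*} [Fintype ι] [Fintype κ] [Nonempty κ]
    {v : κ → ι → ℝ} {s t : ι → ℝ} (h : ∃ k l, v k ⬝ᵥ (s - t) ≠ v l ⬝ᵥ (s - t)) :
    0 < (expMean v s - expMean v t) ⬝ᵥ (s - t) := by
  have key := sum_mul_sum_lt_of_strictMono Real.exp_strictMono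
    (b := fun k => Real.exp (v k ⬝ᵥ t)) (fun k => Real.exp_pos _) h
  have he : ∀ k, Real.exp (v k ⬝ᵥ t) * Real.exp (v k ⬝ᵥ (s - t)) = Real.exp (v k ⬝ᵥ s) := by
    intro k
    rw [← Real.exp_add, dotProduct_sub]
    ring_nf
  simp only [he] at key
  rw [sub_dotProduct, expMean_dotProduct, expMean_dotProduct, sub_pos,
    div_lt_div_iff₀ (sum_exp_pos v t) (sum_exp_pos v s)]
  linarith

lemma dotProduct_sub_expMean_le_card {ι κ : Type*} [Fintype ι] [Fintype κ] [Nonempty κ]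
    (v : κ → ι → ℝ) (t : ι → ℝ) (k : κ) :
    v k ⬝ᵥ t ≤ expMean v t ⬝ᵥ t + Fintype.card κ := by
  rw [← sub_le_iff_le_add', expMean_dotProduct]
  have hZ := sum_exp_pos v t
  have h1 : ∑ l, Real.exp (v l ⬝ᵥ t) * (v k ⬝ᵥ t - v l ⬝ᵥ t) ≤
      Fintype.card κ * ∑ l, Real.exp (v l ⬝ᵥ t) := by
    calc ∑ l, Real.exp (v l ⬝ᵥ t) * (v k ⬝ᵥ t - v l ⬝ᵥ t)
        ≤ ∑ _l : κ, Real.exp (v k ⬝ᵥ t) := by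
          refine Finset.sum_le_sum fun l _ => ?_
          calc Real.exp (v l ⬝ᵥ t) * (v k ⬝ᵥ t - v l ⬝ᵥ t)
              ≤ Real.exp (v l ⬝ᵥ t) * Real.exp (v k ⬝ᵥ t - v l ⬝ᵥ t) := by
                gcongr
                linarith [Real.add_one_le_exp (v k ⬝ᵥ t - v l ⬝ᵥ t)]
            _ = Real.exp (v k ⬝ᵥ t) := by rw [← Real.exp_add]; ring_nf
      _ = Fintype.card κ * Real.exp (v k ⬝ᵥ t) := by simp
      _ ≤ _ := by
          gcongr
          exact Finset.single_le_sum (f := fun l => Real.exp (v l ⬝ᵥ t))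
            (fun l _ => (Real.exp_pos _).le) (Finset.mem_univ k)
  simp only [mul_sub, Finset.sum_sub_distrib, ← Finset.sum_mul] at h1
  rw [sub_le_iff_le_add, ← sub_le_iff_le_add', le_div_iff₀ hZ]
  linarith

lemma expMean_hasDerivAt {ι κ : Type*} [Fintype ι] [Fintype κ] [Nonempty κ]
    (v : κ → ι → ℝ) (t c : ι → ℝ) (j : ι) :
    HasDerivAt (fun r : ℝ => expMean v (t + r • c) j)
      (((∑ k, Real.exp (v k ⬝ᵥ t) * (v k ⬝ᵥ c) * v k j) * (∑ k, Real.exp (v k ⬝ᵥ t)) -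
        (∑ k, Real.exp (v k ⬝ᵥ t) * v k j) * ∑ k, Real.exp (v k ⬝ᵥ t) * (v k ⬝ᵥ c)) /
        (∑ k, Real.exp (v k ⬝ᵥ t)) ^ 2) 0 := by
  simp only [expMean_apply, dotProduct_add, dotProduct_smul, smul_eq_mul]
  have he : ∀ k, HasDerivAt (fun r : ℝ => Real.exp (v k ⬝ᵥ t + r * (v k ⬝ᵥ c)))
      (Real.exp (v k ⬝ᵥ t) * (v k ⬝ᵥ c)) 0 := by
    intro k
    have := (((hasDerivAt_id (0 : ℝ)).mul_const (v k ⬝ᵥ c)).const_add (v k ⬝ᵥ t)).exp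
    simpa using this
  have hN := HasDerivAt.fun_sum (u := Finset.univ) fun k _ => (he k).mul_const (v k j)
  have hZ := HasDerivAt.fun_sum (u := Finset.univ) fun k _ => he k
  have := hN.fun_div hZ (by simpa using (sum_exp_pos v t).ne')
  simpa using this

lemma expMean_contDiff {ι κ : Type*} [Fintype ι] [Fintype κ] [Nonempty κ] (v : κ → ι → ℝ) :
    ContDiff ℝ 1 (expMean v) := by
  rw [contDiff_pi]
  intro j
  simp only [expMean_apply]
  have he : ∀ k, ContDiff ℝ 1 (fun t => Real.exp (v k ⬝ᵥ t)) := fun k => by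
    unfold dotProduct
    fun_prop
  refine ContDiff.div (ContDiff.sum fun k _ => (he k).mul contDiff_const)
    (ContDiff.sum fun k _ => he k) fun t => (sum_exp_pos v t).ne'

section Polytope

variable {l m : ℕ} {A : Matrix (Fin l) (Fin m) ℝ}

lemma convex_closedPolytope : Convex ℝ (closedPolytope A) := by
  rintro x ⟨hx, hx0, hx1⟩ y ⟨hy, hy0, hy1⟩ a b ha hb hab
  refine ⟨by simp [Matrix.mulVec_add, Matrix.mulVec_smul, hx, hy], fun j => ?_, ?_⟩
  · have := hx0 j
    have := hy0 j
    simp only [Pi.add_apply, Pi.smul_apply, smul_eq_mul]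
    positivity
  · simp [Finset.sum_add_distrib, ← Finset.mul_sum, hx1, hy1, hab]

lemma isCompact_closedPolytope : IsCompact (closedPolytope A) := by
  refine IsCompact.of_isClosed_subset (isCompact_univ_pi fun _ : Fin m => isCompact_Icc)
    (s := Set.univ.pi fun _ : Fin m => Set.Icc (0 : ℝ) 1) ?_ ?_
  · refine IsClosed.inter (isClosed_eq (by fun_prop) (by fun_prop)) (IsClosed.inter
      (isClosed_Ici (a := (0 : Fin m → ℝ))) (isClosed_eq (by fun_prop) (by fun_prop)))
  · rintro y ⟨_, hy0, hy1⟩ j _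
    exact ⟨hy0 j, hy1 ▸ Finset.single_le_sum (fun i _ => hy0 i) (Finset.mem_univ j)⟩

lemma add_mem_closedPolytope {y t : Fin m → ℝ} (hy : y ∈ closedPolytope A)
    (ht : A.mulVec t = 0 ∧ ∑ j, t j = 0) (h : ∀ j, 0 ≤ y j + t j) :
    y + t ∈ closedPolytope A :=
  ⟨by simp [Matrix.mulVec_add, hy.1, ht.1], h, by simp [Finset.sum_add_distrib, hy.2.2, ht.2]⟩

lemma sub_mem_of_mem_closedPolytope {x y : Fin m → ℝ} (hx : x ∈ closedPolytope A)
    (hy : y ∈ closedPolytope A) : A.mulVec (x - y) = 0 ∧ ∑ j, (x - y) j = 0 :=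
  ⟨by simp [Matrix.mulVec_sub, hx.1, hy.1], by simp [hx.2.2, hy.2.2]⟩

variable {κ : Type*} {v : κ → Fin m → ℝ}

lemma dotProduct_le_of_forall_extremePoints
    (hv : Set.range v = Set.extremePoints ℝ (closedPolytope A)) {c : Fin m → ℝ} {b : ℝ}
    (h : ∀ k, v k ⬝ᵥ c ≤ b) {x : Fin m → ℝ} (hx : x ∈ closedPolytope A) : x ⬝ᵥ c ≤ b := by
  rw [← closure_convexHull_extremePoints isCompact_closedPolytope convex_closedPolytope,
    ← hv] at hx
  have hlin : IsLinearMap ℝ fun y : Fin m → ℝ => y ⬝ᵥ c :=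
    ⟨fun x y => add_dotProduct x y c, fun a x => smul_dotProduct a x c⟩
  have hcl : IsClosed {y : Fin m → ℝ | y ⬝ᵥ c ≤ b} :=
    isClosed_le (by unfold dotProduct; fun_prop) continuous_const
  refine closure_minimal (convexHull_min ?_ (convex_halfSpace_le hlin b)) hcl hx
  rintro _ ⟨k, rfl⟩
  exact h k

lemma mem_closedPolytope_of_range_eq
    (hv : Set.range v = Set.extremePoints ℝ (closedPolytope A)) (k : κ) :
    v k ∈ closedPolytope A :=
  extremePoints_subset (hv ▸ Set.mem_range_self k)

lemma nonempty_of_range_eq_extremePoints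
    (hv : Set.range v = Set.extremePoints ℝ (closedPolytope A))
    (hne : (closedPolytope A).Nonempty) : Nonempty κ := by
  have := isCompact_closedPolytope.extremePoints_nonempty (E := Fin m → ℝ) hne
  rw [← hv] at this
  exact Set.range_nonempty_iff_nonempty.1 this

lemma expMean_mem_closedPolytope [Fintype κ] [Nonempty κ]
    (hv : Set.range v = Set.extremePoints ℝ (closedPolytope A)) (t : Fin m → ℝ) :
    expMean v t ∈ closedPolytope A :=
  convex_closedPolytope.centerMass_mem (fun _ _ => (Real.exp_pos _).le) (sum_exp_pos v t)
    fun k _ => mem_closedPolytope_of_range_eq hv k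

lemma expMean_pos [Fintype κ] [Nonempty κ]
    (hv : Set.range v = Set.extremePoints ℝ (closedPolytope A)) {y : Fin m → ℝ}
    (hy : y ∈ closedPolytope A) (hy0 : ∀ j, 0 < y j) (t : Fin m → ℝ) (j : Fin m) :
    0 < expMean v t j := by
  rw [expMean_apply]
  refine div_pos (Finset.sum_pos' (fun k _ => mul_nonneg (Real.exp_pos _).le
    ((mem_closedPolytope_of_range_eq hv k).2.1 j)) ?_) (sum_exp_pos v t)
  by_contra! hcon
  have h := dotProduct_le_of_forall_extremePoints hv (c := Pi.single j 1) (b := 0) (fun k => by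
    have := hcon k (Finset.mem_univ k)
    rw [dotProduct_single_one]
    exact nonpos_of_mul_nonpos_right this (Real.exp_pos _)) hy
  rw [dotProduct_single_one] at h
  exact absurd (hy0 j) (not_lt.2 h)

/-- Moving inside the polytope in direction `t` by a step of sup norm `ε`. -/
lemma add_smul_mem_closedPolytope {y t : Fin m → ℝ} (hy : y ∈ closedPolytope A) {ε : ℝ}
    (hε : 0 < ε) (hyε : ∀ j, ε ≤ y j) (ht : A.mulVec t = 0 ∧ ∑ j, t j = 0) (ht0 : t ≠ 0) :
    y + (ε / ‖t‖) • t ∈ closedPolytope A := by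
  have hn : 0 < ‖t‖ := norm_pos_iff.2 ht0
  refine add_mem_closedPolytope hy
    ⟨by simp [Matrix.mulVec_smul, ht.1], by simp [← Finset.mul_sum, ht.2]⟩ fun j => ?_
  have h1 : -‖t‖ ≤ t j := neg_le_of_abs_le (norm_le_pi_norm t j)
  have h2 : ε / ‖t‖ * -‖t‖ ≤ ε / ‖t‖ * t j := by gcongr
  have h3 : ε / ‖t‖ * -‖t‖ = -ε := by field_simp
  have := hyε j
  simp only [Pi.smul_apply, smul_eq_mul]
  linarith

lemma exists_pos_le_apply {y : Fin m → ℝ} (hy0 : ∀ j, 0 < y j) :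
    ∃ ε > 0, ∀ j, ε ≤ y j := by
  obtain h | h := isEmpty_or_nonempty (Fin m)
  · exact ⟨1, one_pos, fun j => h.elim j⟩
  · obtain ⟨j, hj⟩ := Finite.exists_min y
    exact ⟨y j, hy0 j, hj⟩

lemma exists_dotProduct_ne
    (hv : Set.range v = Set.extremePoints ℝ (closedPolytope A)) [Nonempty κ] {y : Fin m → ℝ}
    (hy : y ∈ closedPolytope A) (hy0 : ∀ j, 0 < y j) {t : Fin m → ℝ}
    (ht : A.mulVec t = 0 ∧ ∑ j, t j = 0) (ht0 : t ≠ 0) : ∃ k l, v k ⬝ᵥ t ≠ v l ⬝ᵥ t := by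
  by_contra! hcon
  obtain ⟨k₀⟩ := ‹Nonempty κ›
  obtain ⟨ε, hε, hyε⟩ := exists_pos_le_apply hy0
  have h1 := dotProduct_le_of_forall_extremePoints hv (fun k => (hcon k k₀).le)
    (add_smul_mem_closedPolytope hy hε hyε ht ht0)
  have h2 := dotProduct_le_of_forall_extremePoints hv (c := -t) (b := -(v k₀ ⬝ᵥ t))
    (fun k => by rw [dotProduct_neg, hcon k k₀]) hy
  rw [add_dotProduct, smul_dotProduct, smul_eq_mul] at h1
  rw [dotProduct_neg] at h2
  have hn : 0 < ε / ‖t‖ := div_pos hε (norm_pos_iff.2 ht0)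
  have htt : 0 < t ⬝ᵥ t := (Finset.sum_nonneg fun i _ => mul_self_nonneg (t i)).lt_of_ne'
    (dotProduct_self_eq_zero.not.2 ht0)
  nlinarith [mul_pos hn htt]

lemma norm_le_of_le_expMean [Fintype κ] [Nonempty κ]
    (hv : Set.range v = Set.extremePoints ℝ (closedPolytope A)) {t : Fin m → ℝ}
    (ht : A.mulVec t = 0 ∧ ∑ j, t j = 0) {ε : ℝ} (hε : 0 < ε) (h : ∀ j, ε ≤ expMean v t j) :
    ‖t‖ ≤ Fintype.card κ / ε := by
  rcases eq_or_ne t 0 with rfl | ht0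
  · simp only [norm_zero]
    positivity
  have hn : 0 < ‖t‖ := norm_pos_iff.2 ht0
  have h1 := dotProduct_le_of_forall_extremePoints hv (dotProduct_sub_expMean_le_card v t)
    (add_smul_mem_closedPolytope (expMean_mem_closedPolytope hv t) hε h ht ht0)
  rw [add_dotProduct, smul_dotProduct, smul_eq_mul, add_le_add_iff_left] at h1
  have h2 : ‖t‖ ≤ √(t ⬝ᵥ t) := by
    refine (pi_norm_le_iff_of_nonneg (Real.sqrt_nonneg _)).2 fun j => Real.abs_le_sqrt ?_
    rw [sq]
    exact Finset.single_le_sum (f := fun i => t i * t i) (fun i _ => mul_self_nonneg _)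
      (Finset.mem_univ j)
  have h3 : ‖t‖ ^ 2 ≤ t ⬝ᵥ t := (Real.le_sqrt' hn).1 h2
  rw [le_div_iff₀ hε]
  refine le_trans ?_ h1
  calc ‖t‖ * ε = ε / ‖t‖ * ‖t‖ ^ 2 := by field_simp
    _ ≤ _ := by gcongr

end Polytope

lemma Submodule.exists_mem_dotProduct_eq {m : ℕ} (T : Submodule ℝ (Fin m → ℝ))
    (c : Fin m → ℝ) : ∃ t ∈ T, ∀ s ∈ T, s ⬝ᵥ t = s ⬝ᵥ c := by
  let Φ : T →ₗ[ℝ] Module.Dual ℝ T := (dotProductBilin ℝ ℝ).domRestrict₁₂ T T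
  have hinj : Function.Injective Φ := by
    rw [injective_iff_map_eq_zero]
    intro t ht
    have : (t : Fin m → ℝ) ⬝ᵥ t = 0 := LinearMap.congr_fun ht t
    exact Subtype.ext (dotProduct_self_eq_zero.1 this)
  have hsurj : Function.Surjective Φ :=
    (LinearMap.injective_iff_surjective_of_finrank_eq_finrank
      (Subspace.dual_finrank_eq).symm).1 hinj
  obtain ⟨t, ht⟩ := hsurj (((dotProductBilin ℝ ℝ) c).comp T.subtype)
  refine ⟨t, t.2, fun s hs => ?_⟩
  have : (t : Fin m → ℝ) ⬝ᵥ s = c ⬝ᵥ s := LinearMap.congr_fun ht ⟨s, hs⟩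
  rw [dotProduct_comm, this, dotProduct_comm]

/-- The zero set of a boundary point of the polytope is the zero set of an exposed face. -/
lemma exists_exposed_zeros_eq {l m : ℕ} {A : Matrix (Fin l) (Fin m) ℝ}
    {T : Submodule ℝ (Fin m → ℝ)}
    (hT : ∀ y : Fin m → ℝ, y ∈ T ↔ (A.mulVec y = 0 ∧ ∑ j, y j = 0)) {y x : Fin m → ℝ}
    (hy : y ∈ closedPolytope A) (hy0 : ∀ j, 0 < y j) (hx : x ∈ closedPolytope A) {i : Fin m}
    (hi : x i = 0) :
    ∃ t ∈ T, t ≠ 0 ∧ {j | x j = 0} = {j | ∀ x ∈ {x ∈ closedPolytope A |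
      ∀ y ∈ closedPolytope A, y ⬝ᵥ t ≤ x ⬝ᵥ t}, x j = 0} := by
  classical
  let c : Fin m → ℝ := fun j => if x j = 0 then -1 else 0
  obtain ⟨t, htT, ht⟩ := T.exists_mem_dotProduct_eq c
  have hdiff : ∀ a ∈ closedPolytope A, ∀ b ∈ closedPolytope A,
      a ⬝ᵥ t - b ⬝ᵥ t = a ⬝ᵥ c - b ⬝ᵥ c := by
    intro a ha b hb
    rw [← sub_dotProduct, ← sub_dotProduct]
    exact ht _ ((hT _).2 (sub_mem_of_mem_closedPolytope ha hb))
  have hxc : x ⬝ᵥ c = 0 := Finset.sum_eq_zero fun j _ => by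
    by_cases h : x j = 0 <;> simp [c, h]
  have hterm : ∀ a ∈ closedPolytope A, ∀ j ∈ Finset.univ, a j * c j ≤ 0 := by
    intro a ha j _
    have := ha.2.1 j
    by_cases h : x j = 0 <;> simp [c, h, this]
  have hle : ∀ a ∈ closedPolytope A, a ⬝ᵥ c ≤ 0 := fun a ha => Finset.sum_nonpos (hterm a ha)
  have hzero : ∀ a ∈ closedPolytope A, 0 ≤ a ⬝ᵥ c → ∀ j, x j = 0 → a j = 0 := by
    intro a ha h0 j hj
    have := (Finset.sum_eq_zero_iff_of_nonpos (hterm a ha)).1 (le_antisymm (hle a ha) h0) j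
      (Finset.mem_univ j)
    simpa [c, hj] using this
  refine ⟨t, htT, ?_, ?_⟩
  · rintro rfl
    have h := hdiff y hy x hx
    simp only [dotProduct_zero, sub_zero, hxc] at h
    exact (hy0 i).ne' (hzero y hy h.le i hi)
  · ext j
    refine ⟨fun hj a ha => hzero a ha.1 ?_ j hj, fun h => h x ⟨hx, fun a ha => ?_⟩⟩
    · linarith [hdiff a ha.1 x hx, ha.2 x hx]
    · linarith [hdiff a ha x hx, hle a ha]

lemma LinearMap.exists_comp_comp_eq_self {E F : Type*} [AddCommGroup E] [Module ℝ E]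
    [AddCommGroup F] [Module ℝ F] (L : E →ₗ[ℝ] F) : ∃ M : F →ₗ[ℝ] E, ∀ x, L (M (L x)) = L x := by
  obtain ⟨R, hR⟩ := L.rangeRestrict.exists_rightInverse_of_surjective L.range_rangeRestrict
  obtain ⟨M, hM⟩ := LinearMap.exists_extend R
  refine ⟨M, fun x => ?_⟩
  have h1 : M (L x) = R (L.rangeRestrict x) :=
    LinearMap.congr_fun hM (L.rangeRestrict x)
  rw [h1]
  exact congrArg Subtype.val (LinearMap.congr_fun hR (L.rangeRestrict x))

/-- If positive vectors converge while the linear images of their logarithms converge too, then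
the kernel of the linear map contains a vector that is positive on the zero set of the limit and
vanishes elsewhere. -/
lemma exists_mem_ker_of_tendsto_log {m d : ℕ} (K : (Fin m → ℝ) →ₗ[ℝ] (Fin d → ℝ))
    {x : ℕ → Fin m → ℝ} {x₀ : Fin m → ℝ} {z : Fin d → ℝ} (hpos : ∀ n j, 0 < x n j)
    (hx : Tendsto x atTop (𝓝 x₀))
    (hK : Tendsto (fun n => K fun j => Real.log (x n j)) atTop (𝓝 z)) :
    ∃ u, K u = 0 ∧ (∀ j, 0 ≤ u j) ∧ {j | 0 < u j} = {j | x₀ j = 0} := by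
  classical
  let R : (Fin m → ℝ) →ₗ[ℝ] (Fin m → ℝ) :=
    LinearMap.pi fun j => if x₀ j = 0 then 0 else LinearMap.proj j
  have hRapp : ∀ w j, R w j = if x₀ j = 0 then 0 else w j := by
    intro w j
    by_cases h : x₀ j = 0 <;> simp [R, h]
  obtain ⟨M, hM⟩ := (K.prod R).exists_comp_comp_eq_self
  let lg : ℕ → Fin m → ℝ := fun n j => Real.log (x n j)
  have hxj := tendsto_pi_nhds.1 hx
  have hR : Tendsto (fun n => R (lg n)) atTop
      (𝓝 fun j => if x₀ j = 0 then 0 else Real.log (x₀ j)) := by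
    rw [tendsto_pi_nhds]
    intro j
    simp only [hRapp]
    by_cases h : x₀ j = 0
    · simp [h]
    · simpa [h] using (hxj j).log h
  have hw := (M.continuous_of_finiteDimensional.tendsto _).comp (hK.prodMk_nhds hR)
  have hwj := tendsto_pi_nhds.1 hw
  have hev : ∀ᶠ n in atTop, ∀ j, x₀ j = 0 → 0 < M (K (lg n), R (lg n)) j - lg n j := by
    rw [eventually_all]
    intro j
    by_cases h : x₀ j = 0
    · have hlog : Tendsto (fun n => lg n j) atTop atBot := by
        refine Real.tendsto_log_nhdsGT_zero.comp (tendsto_nhdsWithin_iff.2 ⟨?_, ?_⟩)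
        · simpa [h] using hxj j
        · exact Eventually.of_forall fun n => hpos n j
      have := (hwj j).add_atTop (tendsto_neg_atBot_atTop.comp hlog)
      filter_upwards [this.eventually_gt_atTop 0] with n hn _
      simpa [sub_eq_add_neg] using hn
    · exact Eventually.of_forall fun n h' => absurd h' h
  obtain ⟨n, hn⟩ := hev.exists
  have hLn := Prod.mk.inj (hM (lg n))
  have hoff : ∀ j, x₀ j ≠ 0 → (M (K (lg n), R (lg n)) - lg n) j = 0 := by
    intro j hj
    have : R (M (K (lg n), R (lg n))) j = R (lg n) j := congrFun hLn.2 j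
    rw [hRapp, hRapp, if_neg hj, if_neg hj] at this
    simp [this]
  refine ⟨M (K (lg n), R (lg n)) - lg n, ?_, fun j => ?_, ?_⟩
  · exact (map_sub K _ _).trans (sub_eq_zero.2 hLn.1)
  · by_cases h : x₀ j = 0
    · exact (hn j h).le
    · exact (hoff j h).ge
  · ext j
    refine ⟨fun h => ?_, hn j⟩
    by_contra h0
    exact (ne_of_gt h) (hoff j h0)

lemma isOpenMap_of_injective_fderiv {d : ℕ} {g : (Fin d → ℝ) → (Fin d → ℝ)}
    (hg : ContDiff ℝ 1 g) (hinj : ∀ ξ, Function.Injective (fderiv ℝ g ξ)) : IsOpenMap g := by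
  refine IsOpenMap.of_nhds_le fun ξ => ?_
  have hs : HasStrictFDerivAt g (fderiv ℝ g ξ) ξ :=
    hg.contDiffAt.hasStrictFDerivAt one_ne_zero
  refine (hs.map_nhds_eq_of_surj (LinearMap.range_eq_top.2 ?_)).ge
  exact LinearMap.surjective_of_injective (f := (fderiv ℝ g ξ : (Fin d → ℝ) →ₗ[ℝ] _)) (hinj ξ)

section Bijective

variable {l m d : ℕ} {A : Matrix (Fin l) (Fin m) ℝ} {T : Submodule ℝ (Fin m → ℝ)}
  {κ : Type*} [Fintype κ] {v : κ → Fin m → ℝ}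
  {G : (Fin d → ℝ) →ₗ[ℝ] (Fin m → ℝ)} {K : (Fin m → ℝ) →ₗ[ℝ] (Fin d → ℝ)} {y : Fin m → ℝ}

lemma injective_log_expMean [Nonempty κ]
    (hT : ∀ y : Fin m → ℝ, y ∈ T ↔ (A.mulVec y = 0 ∧ ∑ j, y j = 0))
    (hv : Set.range v = Set.extremePoints ℝ (closedPolytope A))
    (hy : y ∈ closedPolytope A) (hy0 : ∀ j, 0 < y j)
    (hG : Function.Injective G) (hGT : ∀ ξ, G ξ ∈ T)
    (hsign : ∀ t ∈ T, ∀ u, K u = 0 → (∀ j, Real.sign (t j) = Real.sign (u j)) → t = 0) :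
    Function.Injective fun ξ => K fun j => Real.log (expMean v (G ξ) j) := by
  intro ξ ζ h
  by_contra hne
  have hs := expMean_sub_dotProduct_pos (exists_dotProduct_ne hv hy hy0
    ((hT _).1 (T.sub_mem (hGT ξ) (hGT ζ))) (sub_ne_zero.2 (hG.ne hne)))
  have hmem : ∀ ξ, expMean v (G ξ) ∈ closedPolytope A := fun ξ =>
    expMean_mem_closedPolytope hv (G ξ)
  have h0 : expMean v (G ξ) - expMean v (G ζ) = 0 := by
    refine hsign _ ((hT _).2 (sub_mem_of_mem_closedPolytope (hmem ξ) (hmem ζ)))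
      ((fun j => Real.log (expMean v (G ξ) j)) - fun j => Real.log (expMean v (G ζ) j))
      ((map_sub K _ _).trans (sub_eq_zero.2 h)) fun j => ?_
    have h1 := expMean_pos hv hy hy0 (G ξ) j
    have h2 := expMean_pos hv hy hy0 (G ζ) j
    simp only [Pi.sub_apply]
    rcases lt_trichotomy (expMean v (G ξ) j) (expMean v (G ζ) j) with h3 | h3 | h3
    · rw [Real.sign_of_neg (sub_neg.2 h3),
        Real.sign_of_neg (sub_neg.2 (Real.log_lt_log h1 h3))]
    · rw [h3, sub_self, sub_self]
    · rw [Real.sign_of_pos (sub_pos.2 h3),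
        Real.sign_of_pos (sub_pos.2 (Real.log_lt_log h2 h3))]
  rw [h0, zero_dotProduct] at hs
  exact lt_irrefl _ hs

lemma contDiff_log_expMean [Nonempty κ]
    (hpos : ∀ t j, 0 < expMean v t j) :
    ContDiff ℝ 1 fun ξ => K fun j => Real.log (expMean v (G ξ) j) := by
  refine K.toContinuousLinearMap.contDiff.comp (contDiff_pi.2 fun j => ContDiff.log ?_
    fun ξ => (hpos (G ξ) j).ne')
  exact (contDiff_pi.1 (expMean_contDiff v) j).comp G.toContinuousLinearMap.contDiff

lemma sign_div_of_pos (a : ℝ) {b : ℝ} (hb : 0 < b) : Real.sign a = Real.sign (a / b) := by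
  rcases lt_trichotomy a 0 with h | rfl | h
  · rw [Real.sign_of_neg h, Real.sign_of_neg (div_neg_of_neg_of_pos h hb)]
  · rw [zero_div]
  · rw [Real.sign_of_pos h, Real.sign_of_pos (div_pos h hb)]

lemma injective_fderiv_log_expMean [Nonempty κ]
    (hT : ∀ y : Fin m → ℝ, y ∈ T ↔ (A.mulVec y = 0 ∧ ∑ j, y j = 0))
    (hv : Set.range v = Set.extremePoints ℝ (closedPolytope A))
    (hy : y ∈ closedPolytope A) (hy0 : ∀ j, 0 < y j)
    (hG : Function.Injective G) (hGT : ∀ ξ, G ξ ∈ T)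
    (hsign : ∀ t ∈ T, ∀ u, K u = 0 → (∀ j, Real.sign (t j) = Real.sign (u j)) → t = 0)
    (ξ : Fin d → ℝ) :
    Function.Injective (fderiv ℝ (fun ξ => K fun j => Real.log (expMean v (G ξ) j)) ξ) := by
  have hpos := expMean_pos hv hy hy0
  rw [injective_iff_map_eq_zero]
  intro η hη
  by_contra hη0
  have hGη : G η ≠ 0 := fun h => hη0 (hG (h.trans (map_zero G).symm))
  set Z := ∑ k, Real.exp (v k ⬝ᵥ G ξ) with hZdef
  have hZ : 0 < Z := sum_exp_pos v (G ξ)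
  set S := ∑ k, Real.exp (v k ⬝ᵥ G ξ) * (v k ⬝ᵥ G η) with hS
  let q : Fin m → ℝ := fun j =>
    ((∑ k, Real.exp (v k ⬝ᵥ G ξ) * (v k ⬝ᵥ G η) * v k j) * Z -
        (∑ k, Real.exp (v k ⬝ᵥ G ξ) * v k j) * S) / Z ^ 2
  have hqv : q = (Z ^ 2)⁻¹ • (Z • (∑ k, (Real.exp (v k ⬝ᵥ G ξ) * (v k ⬝ᵥ G η)) • v k) -
      S • ∑ k, Real.exp (v k ⬝ᵥ G ξ) • v k) := by
    ext j
    simp only [q, Pi.smul_apply, Pi.sub_apply, Finset.sum_apply, smul_eq_mul, div_eq_inv_mul]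
    ring
  have hq : ∀ j, HasDerivAt (fun r : ℝ => expMean v (G ξ + r • G η) j) (q j) 0 := fun j =>
    expMean_hasDerivAt v (G ξ) (G η) j
  have hqT : q ∈ T := by
    have hvk : ∀ k, A.mulVec (v k) = 0 ∧ ∑ j, v k j = 1 := fun k =>
      have h := mem_closedPolytope_of_range_eq hv k
      ⟨h.1, h.2.2⟩
    have hsum : ∀ w : κ → ℝ, ∑ j, (∑ k, w k • v k) j = ∑ k, w k := by
      intro w
      simp only [Finset.sum_apply, Pi.smul_apply, smul_eq_mul]
      rw [Finset.sum_comm]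
      simp [← Finset.mul_sum, hvk]
    rw [hT, hqv]
    constructor
    · simp [Matrix.mulVec_smul, Matrix.mulVec_sub, Matrix.mulVec_sum, hvk]
    · simp only [Pi.smul_apply, Pi.sub_apply, smul_eq_mul, ← Finset.mul_sum,
        Finset.sum_sub_distrib, hsum]
      rw [← hS, ← hZdef]
      ring
  have hqpos : 0 < q ⬝ᵥ G η := by
    have := sum_mul_sum_lt_of_strictMono strictMono_id
      (b := fun k => Real.exp (v k ⬝ᵥ G ξ)) (fun k => Real.exp_pos _)
      (exists_dotProduct_ne hv hy hy0 ((hT _).1 (hGT η)) hGη)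
    simp only [id] at this
    rw [hqv, smul_dotProduct, smul_eq_mul]
    refine mul_pos (by positivity) ?_
    simp only [sub_dotProduct, smul_dotProduct, sum_dotProduct, smul_eq_mul]
    rw [sub_pos]
    linarith
  let u : Fin m → ℝ := fun j => q j / expMean v (G ξ) j
  have hu : HasDerivAt (fun r : ℝ => K fun j => Real.log (expMean v (G (ξ + r • η)) j))
      (K u) 0 := by
    refine K.toContinuousLinearMap.hasFDerivAt.comp_hasDerivAt (0 : ℝ)
      (hasDerivAt_pi.2 fun j => ?_)
    simp only [map_add, map_smul]
    simpa [u] using (hq j).log (by simpa using (hpos (G ξ) j).ne')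
  have hline : HasDerivAt (fun r : ℝ => ξ + r • η) η 0 := by
    simpa using ((hasDerivAt_id (0 : ℝ)).smul_const η).const_add ξ
  have hg := ((contDiff_log_expMean (G := G) (K := K) hpos).differentiable one_ne_zero
    (ξ + (0 : ℝ) • η)).hasFDerivAt.comp_hasDerivAt (0 : ℝ) hline
  rw [zero_smul, add_zero, hη] at hg
  have hq0 := hsign q hqT u (hu.unique hg) fun j => sign_div_of_pos _ (hpos (G ξ) j)
  rw [hq0, zero_dotProduct] at hqpos
  exact lt_irrefl _ hqpos

lemma isClosed_range_log_expMean [Nonempty κ]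
    (hT : ∀ y : Fin m → ℝ, y ∈ T ↔ (A.mulVec y = 0 ∧ ∑ j, y j = 0))
    (hv : Set.range v = Set.extremePoints ℝ (closedPolytope A))
    (hy : y ∈ closedPolytope A) (hy0 : ∀ j, 0 < y j)
    (hG : Function.Injective G) (hGT : ∀ ξ, G ξ ∈ T)
    (hface : ∀ x ∈ closedPolytope A, ∀ i, x i = 0 →
      ¬ ∃ u, K u = 0 ∧ (∀ j, 0 ≤ u j) ∧ {j | 0 < u j} = {j | x j = 0}) :
    IsClosed (Set.range fun ξ => K fun j => Real.log (expMean v (G ξ) j)) := by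
  have hpos := expMean_pos hv hy hy0
  refine isClosed_of_closure_subset fun z hz => ?_
  obtain ⟨w, hw, hwz⟩ := mem_closure_iff_seq_limit.1 hz
  choose ξ hξ using hw
  obtain ⟨x₀, hx₀, φ, hφ, hlim⟩ := isCompact_closedPolytope.tendsto_subseq
    fun n => expMean_mem_closedPolytope hv (G (ξ n))
  have hKlim : Tendsto (fun n => K fun j => Real.log (expMean v (G (ξ (φ n))) j)) atTop
      (𝓝 z) := by
    simpa only [hξ, Function.comp_def] using hwz.comp hφ.tendsto_atTop
  by_cases hx : ∃ i, x₀ i = 0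
  · obtain ⟨i, hi⟩ := hx
    exact absurd (exists_mem_ker_of_tendsto_log K (fun n j => hpos _ j) hlim hKlim)
      (hface x₀ hx₀ i hi)
  · push Not at hx
    obtain ⟨ε, hε, hεx⟩ := exists_pos_le_apply fun j => (hx₀.2.1 j).lt_of_ne' (hx j)
    obtain ⟨C, _, hC⟩ := LinearMap.exists_antilipschitzWith G (LinearMap.ker_eq_bot.2 hG)
    have hev : ∀ᶠ n in atTop, ξ (φ n) ∈
        Metric.closedBall (0 : Fin d → ℝ) (C * (Fintype.card κ / (ε / 2))) := by
      have : ∀ᶠ n in atTop, ∀ j, ε / 2 ≤ expMean v (G (ξ (φ n))) j := by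
        rw [eventually_all]
        intro j
        exact (tendsto_pi_nhds.1 hlim j).eventually_const_le (by linarith [hεx j])
      filter_upwards [this] with n hn
      have h1 := norm_le_of_le_expMean hv ((hT _).1 (hGT _)) (half_pos hε) hn
      have h2 := hC.le_mul_dist (ξ (φ n)) 0
      rw [map_zero, dist_zero_right (G (ξ (φ n)))] at h2
      rw [Metric.mem_closedBall]
      exact h2.trans (by gcongr)
    obtain ⟨ζ, _, ψ, hψ, hζ⟩ := (isCompact_closedBall _ _).tendsto_subseq' hev.frequently
    have hcont := (contDiff_log_expMean (G := G) (K := K) hpos).continuous.tendsto ζ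
    exact ⟨ζ, tendsto_nhds_unique (hcont.comp hζ) (hKlim.comp hψ.tendsto_atTop)⟩

lemma bijective_log_expMean [Nonempty κ]
    (hT : ∀ y : Fin m → ℝ, y ∈ T ↔ (A.mulVec y = 0 ∧ ∑ j, y j = 0))
    (hv : Set.range v = Set.extremePoints ℝ (closedPolytope A))
    (hy : y ∈ closedPolytope A) (hy0 : ∀ j, 0 < y j)
    (hG : Function.Injective G) (hGT : ∀ ξ, G ξ ∈ T)
    (hsign : ∀ t ∈ T, ∀ u, K u = 0 → (∀ j, Real.sign (t j) = Real.sign (u j)) → t = 0)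
    (hface : ∀ x ∈ closedPolytope A, ∀ i, x i = 0 →
      ¬ ∃ u, K u = 0 ∧ (∀ j, 0 ≤ u j) ∧ {j | 0 < u j} = {j | x j = 0}) :
    Function.Bijective fun ξ => K fun j => Real.log (expMean v (G ξ) j) := by
  refine ⟨injective_log_expMean hT hv hy hy0 hG hGT hsign, Set.range_eq_univ.1 ?_⟩
  refine IsClopen.eq_univ ⟨isClosed_range_log_expMean hT hv hy hy0 hG hGT hface, ?_⟩
    (Set.range_nonempty _)
  exact (isOpenMap_of_injective_fderiv (contDiff_log_expMean (expMean_pos hv hy hy0))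
    (injective_fderiv_log_expMean hT hv hy hy0 hG hGT hsign)).isOpen_range

end Bijective


/-- the sign-vector conditions (i) and (ii) imply that f is a bijection onto the positive orthant. -/
theorem sufficient_conditions_for_bijectivity
    (l m n dP d nP : ℕ)
    (A : Matrix (Fin l) (Fin m) ℝ) (B : Matrix (Fin n) (Fin m) ℝ)
    (T D : Submodule ℝ (Fin m → ℝ))
    (hT : ∀ y : Fin m → ℝ, y ∈ T ↔ (A.mulVec y = 0 ∧ ∑ j, y j = 0))
    (hD : ∀ y : Fin m → ℝ, y ∈ D ↔ (B.mulVec y = 0 ∧ ∑ j, y j = 0))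
    (hdP : Module.finrank ℝ T = dP) (hd : Module.finrank ℝ D = d) (hdPd : dP = d)
    (G : Matrix (Fin m) (Fin dP) ℝ) (H : Matrix (Fin m) (Fin d) ℝ)
    (hGind : LinearIndependent ℝ (fun i : Fin dP => fun j => G j i))
    (hGrange : LinearMap.range G.mulVecLin = T)
    (hHind : LinearIndependent ℝ (fun i : Fin d => fun j => H j i))
    (hHrange : LinearMap.range H.mulVecLin = D)
    (Dperp : Set (Fin m → ℝ))
    (hDperp : Dperp = {u : Fin m → ℝ | ∀ z ∈ D, ∑ j, z j * u j = 0})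
    (P : Set (Fin m → ℝ))
    (hP : P = {y : Fin m → ℝ | A.mulVec y = 0 ∧ (∀ j, 0 < y j) ∧ ∑ j, y j = 1})
    (hPne : P.Nonempty)
    (Pbar : Set (Fin m → ℝ))
    (hPbar : Pbar = {y : Fin m → ℝ | A.mulVec y = 0 ∧ (∀ j, 0 ≤ y j) ∧ ∑ j, y j = 1})
    (v : Fin nP → (Fin m → ℝ))
    (hv : Set.range v = Set.extremePoints ℝ Pbar)
    (p : (Fin dP → ℝ) → (Fin m → ℝ))
    (hp : ∀ ξ, p ξ = (∑ k, Real.exp (∑ j, v k j * G.mulVec ξ j))⁻¹ •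
        ∑ k, Real.exp (∑ j, v k j * G.mulVec ξ j) • v k)
    (f : (Fin dP → ℝ) → (Fin d → ℝ))
    (hf : ∀ ξ, f ξ = fun i => ∏ j, Real.rpow (p ξ j) (H j i))
    (hsign : ¬ ∃ t ∈ T, ∃ u ∈ Dperp, t ≠ 0 ∧ u ≠ 0 ∧
        ∀ j, Real.sign (t j) = Real.sign (u j))
    (hface : ∀ t ∈ T, t ≠ 0 →
      ¬ ∃ u ∈ Dperp, u ≠ 0 ∧ (∀ j, 0 ≤ u j) ∧
        {j : Fin m | 0 < u j} =
          {j : Fin m | ∀ x ∈ {x ∈ Pbar | ∀ y ∈ Pbar, ∑ j', y j' * t j' ≤ ∑ j', x j' * t j'},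
            x j = 0})
    :
    Set.BijOn f Set.univ {z : Fin d → ℝ | ∀ i, 0 < z i} := by
  subst hDperp hP hPbar
  change Set.range v = Set.extremePoints ℝ (closedPolytope A) at hv
  obtain ⟨y, hyA, hy0, hy1⟩ := hPne
  have hy : y ∈ closedPolytope A := ⟨hyA, fun j => (hy0 j).le, hy1⟩
  have : Nonempty (Fin nP) := nonempty_of_range_eq_extremePoints hv ⟨y, hy⟩
  subst hdPd
  have hp' : ∀ ξ, p ξ = expMean v (G.mulVecLin ξ) := hp
  have hker : ∀ u, H.transpose.mulVecLin u = 0 → ∀ z ∈ D, ∑ j, z j * u j = 0 := by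
    intro u hu z hz
    rw [← hHrange] at hz
    obtain ⟨w, rfl⟩ := hz
    change H.mulVec w ⬝ᵥ u = 0
    rw [dotProduct_comm, Matrix.dotProduct_mulVec, ← Matrix.mulVec_transpose]
    change H.transpose.mulVec u = 0 at hu
    rw [hu, zero_dotProduct]
  have hbij := bijective_log_expMean (G := G.mulVecLin) (K := H.transpose.mulVecLin) hT hv hy hy0
    (Matrix.mulVec_injective_iff.2 hGind) (fun ξ => hGrange ▸ LinearMap.mem_range_self _ ξ)
    (fun t ht u hu h => by
      by_contra ht0
      refine hsign ⟨t, ht, u, hker u hu, ht0, ?_, h⟩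
      rintro rfl
      exact ht0 (funext fun j => Real.sign_eq_zero_iff.1 (by simpa using h j)))
    (fun x hx i hi => by
      rintro ⟨u, hu, hu0, huZ⟩
      obtain ⟨t, ht, ht0, hZ⟩ := exists_exposed_zeros_eq hT hy hy0 hx hi
      refine hface t ht ht0 ⟨u, hker u hu, ?_, hu0, huZ.trans hZ⟩
      rintro rfl
      have : i ∈ {j | x j = 0} := hi
      rw [← huZ] at this
      exact lt_irrefl (0 : ℝ) this)
  have hfexp : ∀ ξ i, f ξ i =
      Real.exp (H.transpose.mulVecLin (fun j => Real.log (expMean v (G.mulVecLin ξ) j)) i) := by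
    intro ξ i
    rw [hf, hp']
    change _ = Real.exp (∑ j, H j i * Real.log (expMean v (G.mulVecLin ξ) j))
    rw [Real.exp_sum]
    refine Finset.prod_congr rfl fun j _ => ?_
    rw [mul_comm]
    exact Real.rpow_def_of_pos (expMean_pos hv hy hy0 _ j) _
  refine ⟨fun ξ _ i => ?_, fun ξ _ ζ _ h => hbij.1 (funext fun i => ?_), fun z hz => ?_⟩
  · rw [hfexp]
    exact Real.exp_pos _
  · have := congrFun h i
    rw [hfexp, hfexp] at this
    exact Real.exp_injective this
  · obtain ⟨ξ, hξ⟩ := hbij.2 fun i => Real.log (z i)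
    refine ⟨ξ, Set.mem_univ _, funext fun i => ?_⟩
    exact (hfexp ξ i).trans
      ((congrArg Real.exp (congrFun hξ i)).trans (Real.exp_log (hz i)))
end

section
/- Let c ∈ ℝ^m with c > 0 componentwise and let ȳ ∈ P. Then Y_c = {c ∘ e^u : u ∈ D^⊥} ∩ P and Y_c = {c ∘ e^u : u ∈ D^⊥} ∩ (ȳ + T), where (c ∘ e^u)_j = c_j · e^{u_j} and ȳ + T = {ȳ + t : t ∈ T}. -/
/-- A vector annihilates the column space of `H` iff it annihilates every column of `H`. -/
theorem Matrix.forall_mem_range_sum_mul_eq_zero_iff {m d : Type*} [Fintype m] [Fintype d]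
    (H : Matrix m d ℝ) (u : m → ℝ) :
    (∀ z ∈ LinearMap.range H.mulVecLin, ∑ j, z j * u j = 0) ↔
      ∀ i, ∑ j, H j i * u j = 0 := by
  classical
  constructor
  · intro h i
    simpa using h (H.col i) ⟨Pi.single i 1, by simp⟩
  · rintro h _ ⟨v, rfl⟩
    change dotProduct (H.mulVec v) u = 0
    have hu : Matrix.vecMul u H = 0 := by
      ext i
      simpa [Matrix.vecMul, dotProduct, mul_comm] using h i
    rw [dotProduct_comm, Matrix.dotProduct_mulVec, hu, zero_dotProduct]

/-- Two positive vectors have the same monomials with exponent vector `h` iff the difference of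
their logarithms is orthogonal to `h`. -/
theorem Real.prod_rpow_eq_prod_rpow_iff {m : Type*} [Fintype m] {y c : m → ℝ}
    (hy : ∀ j, 0 < y j) (hc : ∀ j, 0 < c j) (h : m → ℝ) :
    ∏ j, Real.rpow (y j) (h j) = ∏ j, Real.rpow (c j) (h j) ↔
      ∑ j, h j * (Real.log (y j) - Real.log (c j)) = 0 := by
  have key : ∀ x : m → ℝ, (∀ j, 0 < x j) →
      ∏ j, Real.rpow (x j) (h j) = Real.exp (∑ j, h j * Real.log (x j)) := by
    intro x hx
    rw [Real.exp_sum]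
    refine Finset.prod_congr rfl fun j _ => ?_
    rw [mul_comm]
    exact Real.rpow_def_of_pos (hx j) _
  rw [key y hy, key c hc, Real.exp_eq_exp, ← sub_eq_zero, ← Finset.sum_sub_distrib]
  simp only [mul_sub]

/-- A positive vector `y` has the form `c ∘ e^u` with `u ∈ S` iff `log y - log c ∈ S`. -/
theorem Real.mem_image_mul_exp_iff {m : Type*} {y c : m → ℝ}
    (hy : ∀ j, 0 < y j) (hc : ∀ j, 0 < c j) (S : Set (m → ℝ)) :
    y ∈ (fun u : m → ℝ => fun j => c j * Real.exp (u j)) '' S ↔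
      (fun j => Real.log (y j) - Real.log (c j)) ∈ S := by
  constructor
  · rintro ⟨u, hu, rfl⟩
    convert hu using 2 with j
    rw [Real.log_mul (hc j).ne' (Real.exp_ne_zero _), Real.log_exp, add_sub_cancel_left]
  · refine fun h => ⟨_, h, funext fun j => ?_⟩
    simp only [Real.exp_sub, Real.exp_log (hy j), Real.exp_log (hc j)]
    exact mul_div_cancel₀ _ (ne_of_gt (hc j))

/-- Y_c equals the intersection of the exponential set c ∘ e^{D⊥} with P, and also with the affine set ȳ + T. -/
theorem Yc_as_intersection
    (l m n : ℕ) (d : ℕ)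
    (A : Matrix (Fin l) (Fin m) ℝ) (B : Matrix (Fin n) (Fin m) ℝ)
    (T D : Submodule ℝ (Fin m → ℝ))
    (hT : ∀ y : Fin m → ℝ, y ∈ T ↔ (A.mulVec y = 0 ∧ ∑ j, y j = 0))
    (hD : ∀ y : Fin m → ℝ, y ∈ D ↔ (B.mulVec y = 0 ∧ ∑ j, y j = 0))
    (hd : Module.finrank ℝ D = d)
    (Dperp : Set (Fin m → ℝ))
    (hDperp : Dperp = {u : Fin m → ℝ | ∀ z ∈ D, ∑ j, z j * u j = 0})
    (H : Matrix (Fin m) (Fin d) ℝ)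
    (hHind : LinearIndependent ℝ (fun i : Fin d => fun j => H j i))
    (hHrange : LinearMap.range H.mulVecLin = D)
    (P : Set (Fin m → ℝ))
    (hP : P = {y : Fin m → ℝ | A.mulVec y = 0 ∧ (∀ j, 0 < y j) ∧ ∑ j, y j = 1})
    (hPne : P.Nonempty)
    (c : Fin m → ℝ) (hc : ∀ j, 0 < c j)
    (ybar : Fin m → ℝ) (hybar : ybar ∈ P)
    (Yc : Set (Fin m → ℝ))
    (hYc : Yc = {y ∈ P | (fun i => ∏ j, Real.rpow (y j) (H j i)) =
        (fun i => ∏ j, Real.rpow (c j) (H j i))})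
    :
    Yc = ((fun u : Fin m → ℝ => fun j => c j * Real.exp (u j)) '' Dperp) ∩ P ∧
    Yc = ((fun u : Fin m → ℝ => fun j => c j * Real.exp (u j)) '' Dperp) ∩
      {y : Fin m → ℝ | ∃ t ∈ T, y = ybar + t} := by
  have hfst : Yc = ((fun u : Fin m → ℝ => fun j => c j * Real.exp (u j)) '' Dperp) ∩ P := by
    ext y
    rw [hYc, Set.mem_inter_iff, Set.mem_ofPred_eq, and_comm]
    refine and_congr_left fun hyP => ?_
    have hy : ∀ j, 0 < y j := by
      rw [hP] at hyP
      exact hyP.2.1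
    rw [Real.mem_image_mul_exp_iff hy hc, hDperp, ← hHrange, Set.mem_ofPred_eq,
      Matrix.forall_mem_range_sum_mul_eq_zero_iff, funext_iff]
    exact forall_congr' fun i => Real.prod_rpow_eq_prod_rpow_iff hy hc fun j => H j i
  refine ⟨hfst, hfst.trans ?_⟩
  subst hP
  obtain ⟨hA, -, hsum⟩ := hybar
  ext y
  refine and_congr_right ?_
  rintro ⟨u, -, rfl⟩
  constructor
  · rintro ⟨hyA, -, hysum⟩
    refine ⟨_, (hT _).2 ⟨?_, ?_⟩, (add_sub_cancel ybar _).symm⟩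
    · rw [Matrix.mulVec_sub, hyA, hA, sub_zero]
    · simp only [Pi.sub_apply, Finset.sum_sub_distrib, hsum, hysum, sub_self]
  · rintro ⟨t, ht, hyt⟩
    obtain ⟨htA, htsum⟩ := (hT t).1 ht
    refine ⟨?_, fun j => mul_pos (hc j) (Real.exp_pos _), ?_⟩
    · rw [hyt, Matrix.mulVec_add, hA, htA, add_zero]
    · simp only [funext_iff.1 hyt, Pi.add_apply, Finset.sum_add_distrib, hsum, htsum, add_zero]
end

section
/- Let ξ ∈ ℝ^{d_P} be nonzero. For k = 1,…,n_P set μ^k = v^k·(Gξ), and for i = 1,…,d set η_i = Σ_{j=1}^m μ_j^max(Gξ) · H_{ji}. Then for every i ∈ {1,…,d}, as t → ∞, f_i(tξ) · e^{−η_i t} converges to Π_{j=1}^m (Σ_{k : v^k_j ≠ 0, μ^k = μ_j^max(Gξ)} v^k_j)^{H_{ji}}, which is a positive real number. -/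
open Filter Topology in
open Classical in
/-- A finite sum of weighted exponentials, rescaled by its dominant rate `M`, converges to the total
weight of the terms with rate `M`. -/
theorem tendsto_sum_exp_mul_exp_neg {ι : Type*} [Fintype ι] (a w : ι → ℝ) (M : ℝ)
    (hM : ∀ k, w k ≠ 0 → a k ≤ M) :
    Tendsto (fun t : ℝ => (∑ k, Real.exp (t * a k) * w k) * Real.exp (-(M * t))) atTop
      (𝓝 (∑ k ∈ Finset.univ.filter (fun k => w k ≠ 0 ∧ a k = M), w k)) := by
  rw [Finset.sum_filter]
  simp_rw [Finset.sum_mul]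
  refine tendsto_finsetSum _ fun k _ => ?_
  by_cases hw : w k = 0
  · simp [hw]
  have key (t : ℝ) : Real.exp (t * a k) * w k * Real.exp (-(M * t)) =
      Real.exp ((a k - M) * t) * w k := by
    rw [mul_right_comm, ← Real.exp_add]
    ring_nf
  simp_rw [key]
  rcases (hM k hw).eq_or_lt with h | h
  · simp [h, hw]
  · rw [if_neg fun h' => h.ne h'.2, ← zero_mul (w k)]
    exact (Real.tendsto_exp_atBot.comp
      (tendsto_id.const_mul_atTop_of_neg (sub_neg.2 h))).mul_const _

/-- A positive common factor drops out of a monomial whose exponents sum to zero. -/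
theorem prod_const_mul_rpow_of_sum_eq_zero {ι : Type*} [Fintype ι] {c : ℝ} (hc : 0 < c)
    {s h : ι → ℝ} (hs : ∀ j, 0 ≤ s j) (hh : ∑ j, h j = 0) :
    ∏ j, (c * s j) ^ h j = ∏ j, s j ^ h j := by
  simp_rw [fun j => Real.mul_rpow hc.le (hs j) (z := h j)]
  rw [Finset.prod_mul_distrib, ← Real.rpow_sum_of_pos hc, hh, Real.rpow_zero, one_mul]


open Classical in
/-- along the ray tξ, f_i(tξ) e^{-ηᵢ t} converges to a positive limit. -/
theorem asymptotics_along_rays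
    (l m n dP d nP : ℕ)
    (A : Matrix (Fin l) (Fin m) ℝ) (B : Matrix (Fin n) (Fin m) ℝ)
    (T D : Submodule ℝ (Fin m → ℝ))
    (hT : ∀ y : Fin m → ℝ, y ∈ T ↔ (A.mulVec y = 0 ∧ ∑ j, y j = 0))
    (hD : ∀ y : Fin m → ℝ, y ∈ D ↔ (B.mulVec y = 0 ∧ ∑ j, y j = 0))
    (hdP : Module.finrank ℝ T = dP) (hd : Module.finrank ℝ D = d) (hdPd : dP = d)
    (G : Matrix (Fin m) (Fin dP) ℝ) (H : Matrix (Fin m) (Fin d) ℝ)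
    (hGind : LinearIndependent ℝ (fun i : Fin dP => fun j => G j i))
    (hGrange : LinearMap.range G.mulVecLin = T)
    (hHind : LinearIndependent ℝ (fun i : Fin d => fun j => H j i))
    (hHrange : LinearMap.range H.mulVecLin = D)
    (P : Set (Fin m → ℝ))
    (hP : P = {y : Fin m → ℝ | A.mulVec y = 0 ∧ (∀ j, 0 < y j) ∧ ∑ j, y j = 1})
    (hPne : P.Nonempty)
    (Pbar : Set (Fin m → ℝ))
    (hPbar : Pbar = {y : Fin m → ℝ | A.mulVec y = 0 ∧ (∀ j, 0 ≤ y j) ∧ ∑ j, y j = 1})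
    (v : Fin nP → (Fin m → ℝ))
    (hv : Set.range v = Set.extremePoints ℝ Pbar)
    (μmax : (Fin m → ℝ) → (Fin m → ℝ))
    (hμ : ∀ (t : Fin m → ℝ) (j : Fin m),
      IsGreatest {x : ℝ | ∃ k, v k j ≠ 0 ∧ x = ∑ j', v k j' * t j'} (μmax t j))
    (p : (Fin dP → ℝ) → (Fin m → ℝ))
    (hp : ∀ ξ, p ξ = (∑ k, Real.exp (∑ j, v k j * G.mulVec ξ j))⁻¹ •
        ∑ k, Real.exp (∑ j, v k j * G.mulVec ξ j) • v k)
    (f : (Fin dP → ℝ) → (Fin d → ℝ))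
    (hf : ∀ ξ, f ξ = fun i => ∏ j, Real.rpow (p ξ j) (H j i))
    (ξ : Fin dP → ℝ) (hξ : ξ ≠ 0)
    (η : Fin d → ℝ)
    (hη : ∀ i, η i = ∑ j, μmax (G.mulVec ξ) j * H j i)
    :
    ∀ i : Fin d,
      Filter.Tendsto
        (fun t : ℝ => f (t • ξ) i * Real.exp (-(η i) * t)) Filter.atTop
        (nhds (∏ j, Real.rpow
          (∑ k ∈ Finset.univ.filter (fun k => v k j ≠ 0 ∧
              ∑ j', v k j' * G.mulVec ξ j' = μmax (G.mulVec ξ) j), v k j)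
          (H j i))) ∧
      0 < ∏ j, Real.rpow
          (∑ k ∈ Finset.univ.filter (fun k => v k j ≠ 0 ∧
              ∑ j', v k j' * G.mulVec ξ j' = μmax (G.mulVec ξ) j), v k j)
          (H j i) := by
  intro i
  have hv0 : ∀ k j, 0 ≤ v k j := fun k j => by
    have h : v k ∈ Pbar := extremePoints_subset (hv ▸ Set.mem_range_self k)
    rw [hPbar] at h
    exact h.2.1 j
  have hH0 : ∑ j, H j i = 0 := by
    have h : H.mulVecLin (Pi.single i 1) ∈ D := hHrange ▸ LinearMap.mem_range_self _ _
    simpa using ((hD _).1 h).2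
  set L : Fin m → ℝ := fun j => ∑ k ∈ Finset.univ.filter (fun k => v k j ≠ 0 ∧
    ∑ j', v k j' * G.mulVec ξ j' = μmax (G.mulVec ξ) j), v k j with hL
  have hLpos : ∀ j, 0 < L j := fun j => by
    obtain ⟨k, hk, hkm⟩ := (hμ (G.mulVec ξ) j).1
    exact Finset.sum_pos (fun k hk => (hv0 k j).lt_of_ne' (Finset.mem_filter.1 hk).2.1)
      ⟨k, by simp [hk, hkm]⟩
  have hnP : Nonempty (Fin nP) := by
    obtain ⟨y, hy⟩ := hPne
    rw [hP] at hy
    obtain ⟨j, -, -⟩ : ∃ j ∈ Finset.univ, y j ≠ 0 :=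
      Finset.exists_ne_zero_of_sum_ne_zero (by rw [hy.2.2]; exact one_ne_zero)
    obtain ⟨k, -⟩ := (hμ (G.mulVec ξ) j).1
    exact ⟨k⟩
  refine ⟨?_, Finset.prod_pos fun j _ => Real.rpow_pos_of_pos (hLpos j) _⟩
  set S : ℝ → Fin m → ℝ := fun t j =>
    ∑ k, Real.exp (t * ∑ j', v k j' * G.mulVec ξ j') * v k j with hS
  have hS0 : ∀ t j, 0 ≤ S t j := fun t j =>
    Finset.sum_nonneg fun k _ => mul_nonneg (Real.exp_pos _).le (hv0 k j)
  have hf' : ∀ t : ℝ, f (t • ξ) i = ∏ j, S t j ^ H j i := fun t => by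
    have hdot : ∀ k, ∑ j, v k j * G.mulVec (t • ξ) j = t * ∑ j, v k j * G.mulVec ξ j := fun k => by
      simp [Matrix.mulVec_smul, Finset.mul_sum, mul_left_comm]
    have hZ : 0 < (∑ k, Real.exp (t * ∑ j, v k j * G.mulVec ξ j))⁻¹ :=
      inv_pos.2 (Finset.sum_pos (fun k _ => Real.exp_pos _) Finset.univ_nonempty)
    rw [← prod_const_mul_rpow_of_sum_eq_zero hZ (hS0 t) hH0, hf, hp]
    simp only [hdot]
    simp [hS]
  have hfun : (fun t : ℝ => f (t • ξ) i * Real.exp (-(η i) * t)) =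
      fun t => ∏ j, (S t j * Real.exp (-(μmax (G.mulVec ξ) j * t))) ^ H j i := by
    funext t
    simp_rw [fun j => Real.mul_rpow (hS0 t j)
      (Real.exp_pos (-(μmax (G.mulVec ξ) j * t))).le (z := H j i)]
    rw [hf', Finset.prod_mul_distrib]
    congr 1
    simp_rw [← Real.exp_mul]
    rw [← Real.exp_sum, hη, ← Finset.sum_neg_distrib, Finset.sum_mul]
    congr 1
    exact Finset.sum_congr rfl fun j _ => by ring
  rw [hfun]
  exact tendsto_finsetProd _ fun j _ =>
    (tendsto_sum_exp_mul_exp_neg _ _ _ fun k hk => (hμ _ j).2 ⟨k, hk, rfl⟩).rpow_const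
      (Or.inl (hLpos j).ne')
end

section
/- Let U ⊆ ℝ^n be open and connected, and let f : ℝ^n → U be a C¹ map that is proper as a map into U and whose Jacobian determinant det(J_f(x)) is nonzero for all x ∈ ℝ^n. Then f is surjective onto U. -/
/-- A strictly differentiable map whose derivative is everywhere surjective has open range. -/
theorem isOpen_range_of_hasStrictFDerivAt_surjective {E F : Type*}
    [NormedAddCommGroup E] [NormedSpace ℝ E] [CompleteSpace E]
    [NormedAddCommGroup F] [NormedSpace ℝ F] [CompleteSpace F] {f : E → F} {f' : E → E →L[ℝ] F}
    (hf : ∀ x, HasStrictFDerivAt f (f' x) x) (hsurj : ∀ x, (f' x).range = ⊤) :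
    IsOpen (Set.range f) := by
  rw [isOpen_iff_mem_nhds]
  rintro _ ⟨x, rfl⟩
  rw [← (hf x).map_nhds_eq_of_surj (hsurj x)]
  exact Filter.range_mem_map

/-- The range of a continuous map that is proper over `U` is closed relative to `U`. -/
theorem closure_range_inter_subset_of_isCompact_preimage {X Y : Type*} [TopologicalSpace X]
    [TopologicalSpace Y] [T2Space Y] [LocallyCompactSpace Y] {U : Set Y} (hU : IsOpen U)
    {f : X → Y} (hf : Continuous f) (hproper : ∀ K ⊆ U, IsCompact K → IsCompact (f ⁻¹' K)) :
    closure (Set.range f) ∩ U ⊆ Set.range f := by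
  rintro y ⟨hy, hyU⟩
  obtain ⟨K, hK, hKU, hKc⟩ := local_compact_nhds (hU.mem_nhds hyU)
  have hclosed : IsClosed (f '' (f ⁻¹' K)) := ((hproper K hKU hKc).image hf).isClosed
  refine Set.image_subset_range f (f ⁻¹' K) (hclosed.closure_subset ?_)
  rw [mem_closure_iff_nhds] at hy ⊢
  intro t ht
  obtain ⟨_, ⟨hzt, hzK⟩, x, rfl⟩ := hy (t ∩ K) (Filter.inter_mem ht hK)
  exact ⟨f x, hzt, x, hzK, rfl⟩

/-- a proper C¹ map into an open connected set U with nowhere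
vanishing Jacobian determinant is surjective onto U. -/
theorem proper_nonvanishing_jacobian_surjective (n : ℕ) (U : Set (Fin n → ℝ))
    (hUopen : IsOpen U) (hUconn : IsConnected U)
    (f : (Fin n → ℝ) → (Fin n → ℝ)) (hf : ContDiff ℝ 1 f) (hrange : ∀ x, f x ∈ U)
    (hproper : ∀ K ⊆ U, IsCompact K → IsCompact (f ⁻¹' K))
    (hdet : ∀ x, LinearMap.det (fderiv ℝ f x : (Fin n → ℝ) →ₗ[ℝ] (Fin n → ℝ)) ≠ 0) :
    ∀ y ∈ U, ∃ x, f x = y := by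
  have hopen : IsOpen (Set.range f) :=
    isOpen_range_of_hasStrictFDerivAt_surjective
      (fun x => hf.contDiffAt.hasStrictFDerivAt one_ne_zero)
      fun x => (LinearMap.isUnit_iff_range_eq_top _).1
        ((LinearMap.isUnit_iff_isUnit_det _).2 (hdet x).isUnit)
  exact hUconn.isPreconnected.subset_of_closure_inter_subset hopen
    ⟨f 0, hrange 0, 0, rfl⟩
    (closure_range_inter_subset_of_isCompact_preimage hUopen hf.continuous hproper)
end
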